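/- Assume that μ is an isomorphism. Then each of the elements e*_0 e_0 e*_0 and e*_0 e_d e*_0 of T acts as a nonzero operator on the T-module M. -/

import Mathlib

open Polynomial

noncomputable section

/-- The polynomial `τ_i = (λ−θ_0)(λ−θ_1)⋯(λ−θ_{i−1})`. -/
def tauPoly {F : Type*} [Field F] (θ : ℕ → F) (i : ℕ) : Polynomial F :=
  ∏ j ∈ Finset.range i, (X - C (θ j))

/-- The polynomial `η_i = (λ−θ_d)(λ−θ_{d−1})⋯(λ−θ_{d−i+1})`. -/
def etaPoly {F : Type*} [Field F] (d : ℕ) (θ : ℕ → F) (i : ℕ) : Polynomial F :=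
  ∏ j ∈ Finset.range i, (X - C (θ (d - j)))

/-- Generators of the algebra `T`: `a`, `a*`, `e_0,…,e_d`, `e*_0,…,e*_d`. -/
inductive TGen (d : ℕ) : Type
  | a : TGen d
  | astar : TGen d
  | e : Fin (d + 1) → TGen d
  | estar : Fin (d + 1) → TGen d

/-- The defining relations of the algebra `T`. -/
inductive TRel (F : Type*) [Field F] (d : ℕ) (θ θs : ℕ → F) :
    FreeAlgebra F (TGen d) → FreeAlgebra F (TGen d) → Prop
  | ee (i j : Fin (d + 1)) :
      TRel F d θ θs (FreeAlgebra.ι F (TGen.e i) * FreeAlgebra.ι F (TGen.e j))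
        (if i = j then FreeAlgebra.ι F (TGen.e i) else 0)
  | eses (i j : Fin (d + 1)) :
      TRel F d θ θs (FreeAlgebra.ι F (TGen.estar i) * FreeAlgebra.ι F (TGen.estar j))
        (if i = j then FreeAlgebra.ι F (TGen.estar i) else 0)
  | sum_e : TRel F d θ θs (∑ i : Fin (d + 1), FreeAlgebra.ι F (TGen.e i)) 1
  | sum_estar : TRel F d θ θs (∑ i : Fin (d + 1), FreeAlgebra.ι F (TGen.estar i)) 1
  | a_eq : TRel F d θ θs (FreeAlgebra.ι F TGen.a)
      (∑ i : Fin (d + 1), θ (i : ℕ) • FreeAlgebra.ι F (TGen.e i))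
  | astar_eq : TRel F d θ θs (FreeAlgebra.ι F TGen.astar)
      (∑ i : Fin (d + 1), θs (i : ℕ) • FreeAlgebra.ι F (TGen.estar i))
  | trid (i j : Fin (d + 1)) (k : ℕ) (hk : k ≤ d)
      (h : k < max ((i : ℕ) - (j : ℕ)) ((j : ℕ) - (i : ℕ))) :
      TRel F d θ θs (FreeAlgebra.ι F (TGen.estar i) * FreeAlgebra.ι F TGen.a ^ k *
        FreeAlgebra.ι F (TGen.estar j)) 0
  | tridstar (i j : Fin (d + 1)) (k : ℕ) (hk : k ≤ d)
      (h : k < max ((i : ℕ) - (j : ℕ)) ((j : ℕ) - (i : ℕ))) :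
      TRel F d θ θs (FreeAlgebra.ι F (TGen.e i) * FreeAlgebra.ι F TGen.astar ^ k *
        FreeAlgebra.ι F (TGen.e j)) 0

/-- The `F`-algebra `T` presented by the above generators and relations. -/
abbrev TAlg (F : Type*) [Field F] (d : ℕ) (θ θs : ℕ → F) : Type _ :=
  RingQuot (TRel F d θ θs)

/-- The image in `T` of a generator. -/
def tgen (F : Type*) [Field F] (d : ℕ) (θ θs : ℕ → F) (g : TGen d) : TAlg F d θ θs :=
  RingQuot.mkAlgHom F (TRel F d θ θs) (FreeAlgebra.ι F g)

/-- The element `a` of `T`. -/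
def aT (F : Type*) [Field F] (d : ℕ) (θ θs : ℕ → F) : TAlg F d θ θs :=
  tgen F d θ θs TGen.a

/-- The element `a*` of `T`. -/
def asT (F : Type*) [Field F] (d : ℕ) (θ θs : ℕ → F) : TAlg F d θ θs :=
  tgen F d θ θs TGen.astar

/-- The element `e_i` of `T` (defined to be `0` for `i > d`). -/
def eT (F : Type*) [Field F] (d : ℕ) (θ θs : ℕ → F) (i : ℕ) : TAlg F d θ θs :=
  if h : i < d + 1 then tgen F d θ θs (TGen.e ⟨i, h⟩) else 0

/-- The element `e*_i` of `T` (defined to be `0` for `i > d`). -/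
def esT (F : Type*) [Field F] (d : ℕ) (θ θs : ℕ → F) (i : ℕ) : TAlg F d θ θs :=
  if h : i < d + 1 then tgen F d θ θs (TGen.estar ⟨i, h⟩) else 0

/-- Conditions (i) and (iii): the `θ_i` are mutually distinct, the `θ*_i` are mutually
distinct, and the expressions `(θ_{i-2}−θ_{i+1})/(θ_{i-1}−θ_i)`,
`(θ*_{i-2}−θ*_{i+1})/(θ*_{i-1}−θ*_i)` are equal and independent of `i` for `2 ≤ i ≤ d−1`. -/
def EigCond (F : Type*) [Field F] (d : ℕ) (θ θs : ℕ → F) : Prop :=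
  (∀ i j, i ≤ d → j ≤ d → i ≠ j → θ i ≠ θ j) ∧
  (∀ i j, i ≤ d → j ≤ d → i ≠ j → θs i ≠ θs j) ∧
  ∃ β : F, ∀ i, 2 ≤ i → i + 1 ≤ d →
    θ (i - 2) - θ (i + 1) = β * (θ (i - 1) - θ i) ∧
    θs (i - 2) - θs (i + 1) = β * (θs (i - 1) - θs i)

/-- The subalgebra `D` of `T` generated by `a`, as an `F`-subspace. -/
def Dsub (F : Type*) [Field F] (d : ℕ) (θ θs : ℕ → F) : Submodule F (TAlg F d θ θs) :=
  Subalgebra.toSubmodule (Algebra.adjoin F {aT F d θ θs})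

/-- The subalgebra `D*` of `T` generated by `a*`, as an `F`-subspace. -/
def DsSub (F : Type*) [Field F] (d : ℕ) (θ θs : ℕ → F) : Submodule F (TAlg F d θ θs) :=
  Subalgebra.toSubmodule (Algebra.adjoin F {asT F d θ θs})

end

noncomputable section

/-- A tridiagonal system on `V` of diameter `d`, with data `(A; {E_i}; A*; {E*_i})`,
eigenvalue sequence `θ` and dual eigenvalue sequence `θs`.  The families `E`, `Es` are the
orderings of the primitive idempotents of `A`, `A*` (so the `E_i V` are the eigenspaces of the
diagonalizable map `A`, ordered so that the tridiagonal conditions hold, and similarly for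
`A*`), and the last condition is the irreducibility condition (iv). -/
def IsTDSystem (F : Type*) [Field F] (V : Type*) [AddCommGroup V] [Module F V]
    (d : ℕ) (A As : V →ₗ[F] V) (E Es : ℕ → (V →ₗ[F] V)) (θ θs : ℕ → F) : Prop :=
  FiniteDimensional F V ∧ 0 < Module.finrank F V ∧
  (∀ i j, i ≤ d → j ≤ d → i ≠ j → θ i ≠ θ j) ∧
  (∀ i j, i ≤ d → j ≤ d → i ≠ j → θs i ≠ θs j) ∧
  (∀ i, i ≤ d → E i ≠ 0) ∧
  (∀ i, i ≤ d → Es i ≠ 0) ∧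
  (∀ i j, i ≤ d → j ≤ d → E i ∘ₗ E j = if i = j then E i else 0) ∧
  (∀ i j, i ≤ d → j ≤ d → Es i ∘ₗ Es j = if i = j then Es i else 0) ∧
  (∑ i ∈ Finset.range (d + 1), E i) = LinearMap.id ∧
  (∑ i ∈ Finset.range (d + 1), Es i) = LinearMap.id ∧
  A = ∑ i ∈ Finset.range (d + 1), θ i • E i ∧
  As = ∑ i ∈ Finset.range (d + 1), θs i • Es i ∧
  (∀ i, i ≤ d → Submodule.map As (LinearMap.range (E i)) ≤
    (if i = 0 then ⊥ else LinearMap.range (E (i - 1))) ⊔ LinearMap.range (E i) ⊔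
      (if i = d then ⊥ else LinearMap.range (E (i + 1)))) ∧
  (∀ i, i ≤ d → Submodule.map A (LinearMap.range (Es i)) ≤
    (if i = 0 then ⊥ else LinearMap.range (Es (i - 1))) ⊔ LinearMap.range (Es i) ⊔
      (if i = d then ⊥ else LinearMap.range (Es (i + 1)))) ∧
  (∀ W : Submodule F V, (∀ w ∈ W, A w ∈ W) → (∀ w ∈ W, As w ∈ W) → W = ⊥ ∨ W = ⊤)

/-- A sharp tridiagonal system with parameter array `(θ; θs; ζ)`:  a tridiagonal system
which is sharp (`dim E*_0 V = 1`) and whose split sequence is `ζ`, i.e.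
`E*_0 τ_i(A) E*_0 = ζ_i E*_0 / ((θ*_0−θ*_1)⋯(θ*_0−θ*_i))` for `0 ≤ i ≤ d`. -/
def SharpTDWithArray (F : Type*) [Field F] (V : Type*) [AddCommGroup V] [Module F V]
    (d : ℕ) (A As : V →ₗ[F] V) (E Es : ℕ → (V →ₗ[F] V)) (θ θs ζ : ℕ → F) : Prop :=
  IsTDSystem F V d A As E Es θ θs ∧
  Module.finrank F (LinearMap.range (Es 0)) = 1 ∧
  ∀ i, i ≤ d → Es 0 ∘ₗ (Polynomial.aeval A (tauPoly θ i)) ∘ₗ Es 0 =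
    (ζ i / ∏ h ∈ Finset.Icc 1 i, (θs 0 - θs h)) • Es 0

/-- The action of an element `x` of `T` on a `T`-module `M`, as an `F`-linear map. -/
def actL {F : Type*} [Field F] {d : ℕ} {θ θs : ℕ → F} {M : Type*} [AddCommGroup M]
    [Module F M] [Module (TAlg F d θ θs) M] [IsScalarTower F (TAlg F d θ θs) M]
    (x : TAlg F d θ θs) : M →ₗ[F] M where
  toFun m := x • m
  map_add' := smul_add x
  map_smul' c m := (smul_comm c x m).symm

/-- The `F`-linear map `T → M`, `t ↦ t • v`, for a vector `v` of a `T`-module `M`. -/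
def applyVec {F : Type*} [Field F] {d : ℕ} {θ θs : ℕ → F} {M : Type*} [AddCommGroup M]
    [Module F M] [Module (TAlg F d θ θs) M] [IsScalarTower F (TAlg F d θ θs) M]
    (v : M) : TAlg F d θ θs →ₗ[F] M where
  toFun t := t • v
  map_add' x y := add_smul x y v
  map_smul' c t := smul_assoc c t v

/-- The `F`-subspace `e*_0 T e*_0` of `T`. -/
def corner (F : Type*) [Field F] (d : ℕ) (θ θs : ℕ → F) : Submodule F (TAlg F d θ θs) :=
  LinearMap.range ((LinearMap.mulLeft F (esT F d θ θs 0)).comp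
    (LinearMap.mulRight F (esT F d θ θs 0)))

/-- The properties characterizing the homomorphism `μ : F[x_1,…,x_d] → e*_0 T e*_0`:
it is `F`-linear, unital (with `1 ↦ e*_0`, the identity of `e*_0Te*_0`), multiplicative,
sends `x_i ↦ e*_0 τ_i(a) e*_0` for `1 ≤ i ≤ d`, and is onto `e*_0 T e*_0`. -/
def MuProps (F : Type*) [Field F] (d : ℕ) (θ θs : ℕ → F)
    (μ : MvPolynomial (Fin d) F →ₗ[F] TAlg F d θ θs) : Prop :=
  μ 1 = esT F d θ θs 0 ∧
  (∀ p q, μ (p * q) = μ p * μ q) ∧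
  (∀ i : Fin d, μ (MvPolynomial.X i) =
    esT F d θ θs 0 * (Polynomial.aeval (aT F d θ θs) (tauPoly θ ((i : ℕ) + 1))) *
      esT F d θ θs 0) ∧
  LinearMap.range μ = corner F d θ θs

/-- Conditions (ii) on the split sequence: `ζ_0 = 1`, `ζ_d ≠ 0` and
`Σ_{i=0}^d η_{d−i}(θ_0) η*_{d−i}(θ*_0) ζ_i ≠ 0`. -/
def ZetaCond (F : Type*) [Field F] (d : ℕ) (θ θs : ℕ → F) (ζ : ℕ → F) : Prop :=
  ζ 0 = 1 ∧ ζ d ≠ 0 ∧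
  (∑ i ∈ Finset.range (d + 1),
    (etaPoly d θ (d - i)).eval (θ 0) * (etaPoly d θs (d - i)).eval (θs 0) * ζ i) ≠ 0

/-- The element `g_i = e*_0 τ_i(a) e*_0 − ζ_i e*_0/((θ*_0−θ*_1)⋯(θ*_0−θ*_i))` of `T`. -/
def gElt (F : Type*) [Field F] (d : ℕ) (θ θs : ℕ → F) (ζ : ℕ → F) (i : ℕ) :
    TAlg F d θ θs :=
  esT F d θ θs 0 * (Polynomial.aeval (aT F d θ θs) (tauPoly θ i)) * esT F d θ θs 0 -
    (ζ i / ∏ h ∈ Finset.Icc 1 i, (θs 0 - θs h)) • esT F d θ θs 0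

/-- The left ideal `J = T(1−e*_0) + Σ_{i=1}^d T g_i` of `T`, as a submodule of `T` over
itself (with the left regular action). -/
def Jideal (F : Type*) [Field F] (d : ℕ) (θ θs : ℕ → F) (ζ : ℕ → F) :
    Submodule (TAlg F d θ θs) (TAlg F d θ θs) :=
  Submodule.span (TAlg F d θ θs)
    ({1 - esT F d θ θs 0} ∪ (gElt F d θ θs ζ '' Set.Icc 1 d))

/-- The `F`-subspace `D D* D D* D ⋯ D D* D` of `T` with `n+1` factors `D`. -/
def DDchain (F : Type*) [Field F] (d : ℕ) (θ θs : ℕ → F) : ℕ → Submodule F (TAlg F d θ θs)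
  | 0 => Dsub F d θ θs
  | n + 1 => DDchain F d θ θs n * DsSub F d θ θs * Dsub F d θ θs

/-- The `F`-subspace `e*_r D e*_{κ 1} D e*_{κ 2} ⋯ D e*_{κ m}` of `T`. -/
def esChain (F : Type*) [Field F] (d : ℕ) (θ θs : ℕ → F) (r : ℕ) (κ : ℕ → ℕ) :
    ℕ → Submodule F (TAlg F d θ θs)
  | 0 => Submodule.span F {esT F d θ θs r}
  | m + 1 => esChain F d θ θs r κ m * Dsub F d θ θs *
      Submodule.span F {esT F d θ θs (κ (m + 1))}

/-- The sequence `(c_0, c_1, …, c_m)` is convex: `c_{i−1} − c_i ≥ c_i − c_{i+1}`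
for `1 ≤ i ≤ m−1`. -/
def ConvexSeq (c : ℕ → ℤ) (m : ℕ) : Prop :=
  ∀ i, 1 ≤ i → i + 1 ≤ m → c i - c (i + 1) ≤ c (i - 1) - c i

end

section Helpers

variable {F : Type*} [Field F]

/-- Newton expansion of `(λ−θ_1)⋯(λ−θ_n)` in the basis `τ_0,…,τ_n`. -/
theorem prod_succ_eq_sum_tauPoly (θ : ℕ → F) (n : ℕ) :
    ∏ j ∈ Finset.range n, (X - C (θ (j + 1))) =
      ∑ i ∈ Finset.range (n + 1),
        (∏ j ∈ Finset.Ico i n, (θ 0 - θ (j + 1))) • tauPoly θ i := by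
  induction n with
  | zero => simp [tauPoly]
  | succ n ih =>
    have hstep : ∀ i ∈ Finset.range (n + 1),
        (∏ j ∈ Finset.Ico i (n + 1), (θ 0 - θ (j + 1))) • tauPoly θ i =
          (θ 0 - θ (n + 1)) • ((∏ j ∈ Finset.Ico i n, (θ 0 - θ (j + 1))) • tauPoly θ i) := by
      intro i hi
      rw [Finset.prod_Ico_succ_top (by simpa [Nat.lt_succ_iff] using hi), smul_smul, mul_comm]
    rw [Finset.sum_range_succ, Finset.sum_congr rfl hstep, ← Finset.smul_sum, ← ih,
      Finset.prod_range_succ, tauPoly, Finset.prod_range_succ']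
    simp only [Finset.Ico_self, Finset.prod_empty, one_smul, smul_eq_C_mul, C_sub]
    ring

theorem etaPoly_sub_eq (d : ℕ) (θ : ℕ → F) {i : ℕ} (hi : i ≤ d) :
    etaPoly d θ (d - i) = ∏ j ∈ Finset.Ico i d, (X - C (θ (j + 1))) := by
  rw [etaPoly, Finset.prod_Ico_eq_prod_range,
    ← Finset.prod_range_reflect (fun k => X - C (θ (i + k + 1)))]
  refine Finset.prod_congr rfl fun j hj => ?_
  rw [Finset.mem_range] at hj
  rw [show i + (d - i - 1 - j) + 1 = d - j by omega]

theorem etaPoly_sub_eval (d : ℕ) (θ : ℕ → F) {i : ℕ} (hi : i ≤ d) (x : F) :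
    (etaPoly d θ (d - i)).eval x = ∏ j ∈ Finset.Ico i d, (x - θ (j + 1)) := by
  simp [etaPoly_sub_eq d θ hi, eval_prod]

theorem etaPoly_eq_sum_tauPoly (d : ℕ) (θ : ℕ → F) :
    etaPoly d θ d =
      ∑ i ∈ Finset.range (d + 1), (etaPoly d θ (d - i)).eval (θ 0) • tauPoly θ i := by
  have h0 := etaPoly_sub_eq d θ (Nat.zero_le d)
  rw [Nat.sub_zero, Nat.Ico_zero_eq_range] at h0
  rw [h0, prod_succ_eq_sum_tauPoly]
  refine Finset.sum_congr rfl fun i hi => ?_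
  rw [etaPoly_sub_eval d θ (Finset.mem_range_succ_iff.mp hi)]

variable {d : ℕ} {θ θs : ℕ → F}

theorem tgen_e_mul (i j : Fin (d + 1)) :
    tgen F d θ θs (.e i) * tgen F d θ θs (.e j) = if i = j then tgen F d θ θs (.e i) else 0 := by
  have := RingQuot.mkAlgHom_rel F (TRel.ee (F := F) (θ := θ) (θs := θs) i j)
  rw [map_mul] at this
  rw [tgen, tgen, this]
  split_ifs <;> simp

theorem esT_zero_mul_self : esT F d θ θs 0 * esT F d θ θs 0 = esT F d θ θs 0 := by
  have := RingQuot.mkAlgHom_rel F (TRel.eses (F := F) (θ := θ) (θs := θs) (0 : Fin (d + 1)) 0)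
  rw [map_mul, if_pos rfl] at this
  simpa [esT, tgen] using this

theorem sum_tgen_e : ∑ i : Fin (d + 1), tgen F d θ θs (.e i) = 1 := by
  have := RingQuot.mkAlgHom_rel F (TRel.sum_e (F := F) (d := d) (θ := θ) (θs := θs))
  rw [map_sum, map_one] at this
  exact this

theorem aT_eq_sum : aT F d θ θs = ∑ i : Fin (d + 1), θ i • tgen F d θ θs (.e i) := by
  have := RingQuot.mkAlgHom_rel F (TRel.a_eq (F := F) (d := d) (θ := θ) (θs := θs))
  rw [map_sum] at this
  simp only [map_smul] at this
  exact this

theorem aT_mul_tgen_e (i : Fin (d + 1)) :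
    aT F d θ θs * tgen F d θ θs (.e i) = θ i • tgen F d θ θs (.e i) := by
  simp [aT_eq_sum, Finset.sum_mul, tgen_e_mul]

theorem aeval_aT_mul_tgen_e (p : F[X]) (i : Fin (d + 1)) :
    aeval (aT F d θ θs) p * tgen F d θ θs (.e i) = p.eval (θ i) • tgen F d θ θs (.e i) := by
  induction p using Polynomial.induction_on' with
  | add p q hp hq => simp only [map_add, add_mul, hp, hq, eval_add, add_smul]
  | monomial n c =>
    have hpow : ∀ n : ℕ, aT F d θ θs ^ n * tgen F d θ θs (.e i) =
        θ i ^ n • tgen F d θ θs (.e i) := by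
      intro n
      induction n with
      | zero => simp
      | succ n ih => rw [pow_succ, mul_assoc, aT_mul_tgen_e, mul_smul_comm, ih, smul_smul, pow_succ']
    rw [aeval_monomial, mul_assoc, hpow, eval_monomial, ← Algebra.smul_def, smul_smul]

theorem aeval_aT_eq_sum (p : F[X]) :
    aeval (aT F d θ θs) p = ∑ i : Fin (d + 1), p.eval (θ i) • tgen F d θ θs (.e i) := by
  simp_rw [← aeval_aT_mul_tgen_e]
  rw [← Finset.mul_sum, sum_tgen_e, mul_one]

/-- A polynomial vanishing at every `θ_i` except `θ_k` evaluates at `a` to a multiple of `e_k`. -/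
theorem aeval_aT_eq_smul_eT (p : F[X]) {k : ℕ} (hk : k ≤ d)
    (hp : ∀ i ≤ d, i ≠ k → p.eval (θ i) = 0) :
    aeval (aT F d θ θs) p = p.eval (θ k) • eT F d θ θs k := by
  rw [aeval_aT_eq_sum, Finset.sum_eq_single (⟨k, Nat.lt_succ_of_le hk⟩ : Fin (d + 1)), eT,
    dif_pos (Nat.lt_succ_of_le hk)]
  · intro i _ hi
    rw [hp i (Nat.lt_succ_iff.mp i.2) fun hik => hi (Fin.ext hik), zero_smul]
  · simp

theorem aeval_aT_tauPoly :
    aeval (aT F d θ θs) (tauPoly θ d) = (tauPoly θ d).eval (θ d) • eT F d θ θs d := by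
  refine aeval_aT_eq_smul_eT _ le_rfl fun i hi hne => ?_
  rw [tauPoly, eval_prod]
  exact Finset.prod_eq_zero (Finset.mem_range.mpr (lt_of_le_of_ne hi hne)) (by simp)

theorem aeval_aT_etaPoly :
    aeval (aT F d θ θs) (etaPoly d θ d) = (etaPoly d θ d).eval (θ 0) • eT F d θ θs 0 := by
  refine aeval_aT_eq_smul_eT _ (Nat.zero_le d) fun i hi hne => ?_
  rw [etaPoly, eval_prod]
  refine Finset.prod_eq_zero (i := d - i) (Finset.mem_range.mpr (by omega)) ?_
  simp [Nat.sub_sub_self hi]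

theorem esT_zero_mul_gElt_and_gElt_mul_esT_zero (ζ : ℕ → F) (i : ℕ) :
    esT F d θ θs 0 * gElt F d θ θs ζ i = gElt F d θ θs ζ i ∧
      gElt F d θ θs ζ i * esT F d θ θs 0 = gElt F d θ θs ζ i := by
  constructor
  · simp only [gElt, mul_sub, mul_smul_comm, ← mul_assoc, esT_zero_mul_self]
  · simp only [gElt, sub_mul, smul_mul_assoc, mul_assoc, esT_zero_mul_self]

/-- Under `μ`, the corner of `J` consists of polynomials vanishing at the point determined
by the split sequence. -/
theorem exists_eval_eq_zero_of_mem_Jideal {μ : MvPolynomial (Fin d) F →ₗ[F] TAlg F d θ θs}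
    (hμ : MuProps F d θ θs μ) (ζ : ℕ → F) {x : TAlg F d θ θs} (hx : x ∈ Jideal F d θ θs ζ) :
    ∀ t, ∃ p, μ p = esT F d θ θs 0 * (t * x) * esT F d θ θs 0 ∧
      MvPolynomial.eval (fun i : Fin d =>
        ζ (i + 1) / ∏ h ∈ Finset.Icc 1 ((i : ℕ) + 1), (θs 0 - θs h)) p = 0 := by
  obtain ⟨hone, hmul, hX, hrange⟩ := hμ
  induction hx using Submodule.span_induction with
  | mem x hx =>
    intro t
    rcases hx with rfl | ⟨i, ⟨hi1, hid⟩, rfl⟩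
    · refine ⟨0, ?_, map_zero _⟩
      rw [map_zero, mul_assoc, mul_assoc, sub_mul, one_mul, esT_zero_mul_self, sub_self,
        mul_zero, mul_zero]
    · obtain ⟨j, rfl⟩ : ∃ j, i = j + 1 := ⟨i - 1, by omega⟩
      obtain ⟨q, hq⟩ : esT F d θ θs 0 * (t * esT F d θ θs 0) ∈ LinearMap.range μ := by
        rw [hrange]
        exact ⟨t, rfl⟩
      obtain ⟨hleft, hright⟩ := esT_zero_mul_gElt_and_gElt_mul_esT_zero (θ := θ) (θs := θs) (d := d) ζ (j + 1)
      refine ⟨q * (MvPolynomial.X ⟨j, hid⟩ -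
        (ζ (j + 1) / ∏ h ∈ Finset.Icc 1 (j + 1), (θs 0 - θs h)) • 1), ?_, ?_⟩
      · rw [hmul, hq, map_sub, map_smul, hone, hX]
        change _ * gElt F d θ θs ζ (j + 1) = _
        rw [mul_assoc, mul_assoc, hleft, mul_assoc, mul_assoc, hright]
      · simp [MvPolynomial.smul_eval]
  | zero => exact fun t => ⟨0, by simp, map_zero _⟩
  | add x y _ _ hx hy =>
    intro t
    obtain ⟨p, hp, hp0⟩ := hx t
    obtain ⟨q, hq, hq0⟩ := hy t
    exact ⟨p + q, by rw [map_add, hp, hq, mul_add, mul_add, add_mul],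
      by rw [map_add, hp0, hq0, add_zero]⟩
  | smul s x _ hx =>
    intro t
    obtain ⟨p, hp, hp0⟩ := hx (t * s)
    exact ⟨p, by rw [hp, smul_eq_mul, mul_assoc t], hp0⟩

theorem esT_zero_notMem_Jideal {μ : MvPolynomial (Fin d) F →ₗ[F] TAlg F d θ θs}
    (hμ : MuProps F d θ θs μ) (hinj : Function.Injective μ) (ζ : ℕ → F) :
    esT F d θ θs 0 ∉ Jideal F d θ θs ζ := by
  intro hmem
  obtain ⟨p, hp, hp0⟩ := exists_eval_eq_zero_of_mem_Jideal hμ ζ hmem 1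
  rw [one_mul, esT_zero_mul_self, esT_zero_mul_self, ← hμ.1] at hp
  rw [hinj hp, map_one] at hp0
  exact one_ne_zero hp0

theorem gElt_mem_Jideal {ζ : ℕ → F} (hζ : ζ 0 = 1) {i : ℕ} (hi : i ≤ d) :
    gElt F d θ θs ζ i ∈ Jideal F d θ θs ζ := by
  rcases Nat.eq_zero_or_pos i with rfl | hpos
  · simp [gElt, tauPoly, hζ, esT_zero_mul_self]
  · exact Submodule.subset_span (Or.inr ⟨i, ⟨hpos, hi⟩, rfl⟩)

theorem exists_smul_ne_zero_of_sub_mem {μ : MvPolynomial (Fin d) F →ₗ[F] TAlg F d θ θs}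
    (hμ : MuProps F d θ θs μ) (hinj : Function.Injective μ) {ζ : ℕ → F}
    {x : TAlg F d θ θs} {c s : F} (hs : s ≠ 0)
    (hx : c • x - s • esT F d θ θs 0 ∈ Jideal F d θ θs ζ) :
    ∃ m : TAlg F d θ θs ⧸ Jideal F d θ θs ζ, x • m ≠ 0 := by
  refine ⟨Submodule.Quotient.mk 1, fun h0 => esT_zero_notMem_Jideal hμ hinj ζ ?_⟩
  rw [← Submodule.Quotient.mk_smul, smul_eq_mul, mul_one, Submodule.Quotient.mk_eq_zero] at h0
  have hmem := sub_mem (Submodule.smul_of_tower_mem _ c h0) hx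
  rw [sub_sub_cancel] at hmem
  simpa [smul_smul, hs] using Submodule.smul_of_tower_mem _ s⁻¹ hmem

end Helpers

/-- If `μ` is an isomorphism then each of `e*_0 e_0 e*_0` and `e*_0 e_d e*_0` acts as a
nonzero operator on `M = T/J`. -/
theorem stmt13 {F : Type*} [Field F] (d : ℕ) (θ θs : ℕ → F) (h : EigCond F d θ θs)
    (μ : MvPolynomial (Fin d) F →ₗ[F] TAlg F d θ θs) (hμ : MuProps F d θ θs μ)
    (hinj : Function.Injective μ)
    (ζ : ℕ → F) (hζ : ZetaCond F d θ θs ζ) :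
    (∃ m : TAlg F d θ θs ⧸ Jideal F d θ θs ζ,
      (esT F d θ θs 0 * eT F d θ θs 0 * esT F d θ θs 0) • m ≠ 0) ∧
    (∃ m : TAlg F d θ θs ⧸ Jideal F d θ θs ζ,
      (esT F d θ θs 0 * eT F d θ θs d * esT F d θ θs 0) • m ≠ 0) := by
  obtain ⟨-, hθs, -⟩ := h
  obtain ⟨hζ0, hζd, hζsum⟩ := hζ
  have hne : ∀ i ≤ d, ∏ j ∈ Finset.Icc 1 i, (θs 0 - θs j) ≠ 0 := by
    intro i hi
    refine Finset.prod_ne_zero_iff.mpr fun j hj => sub_ne_zero.mpr ?_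
    rw [Finset.mem_Icc] at hj
    exact hθs 0 j (Nat.zero_le d) (by omega) (by omega)
  constructor
  · refine exists_smul_ne_zero_of_sub_mem hμ hinj (c := (etaPoly d θ d).eval (θ 0))
      (s := ∑ i ∈ Finset.range (d + 1), (etaPoly d θ (d - i)).eval (θ 0) *
        (ζ i / ∏ j ∈ Finset.Icc 1 i, (θs 0 - θs j))) ?_ ?_
    · intro hzero
      apply hζsum
      rw [← mul_zero (∏ j ∈ Finset.Icc 1 d, (θs 0 - θs j)), ← hzero, Finset.mul_sum]
      refine Finset.sum_congr rfl fun i hi => ?_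
      have hid := Finset.mem_range_succ_iff.mp hi
      have hsplit : ∏ j ∈ Finset.Icc 1 d, (θs 0 - θs j) =
          (∏ j ∈ Finset.Icc 1 i, (θs 0 - θs j)) * (etaPoly d θs (d - i)).eval (θs 0) := by
        rw [etaPoly_sub_eval d θs hid, Finset.prod_Ico_add' (fun j => θs 0 - θs j) i d 1,
          ← Finset.Ico_add_one_right_eq_Icc, ← Finset.Ico_add_one_right_eq_Icc,
          Finset.prod_Ico_consecutive _ (by omega) (by omega)]
      rw [hsplit]
      field_simp [hne i hid]
    · rw [← smul_mul_assoc, ← mul_smul_comm, ← aeval_aT_etaPoly, etaPoly_eq_sum_tauPoly,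
        map_sum, Finset.mul_sum, Finset.sum_mul, Finset.sum_smul, ← Finset.sum_sub_distrib]
      refine Submodule.sum_mem _ fun i hi => ?_
      rw [map_smul, mul_smul_comm, smul_mul_assoc]
      convert Submodule.smul_of_tower_mem (Jideal F d θ θs ζ) ((etaPoly d θ (d - i)).eval (θ 0))
        (gElt_mem_Jideal hζ0 (Finset.mem_range_succ_iff.mp hi)) using 1
      rw [gElt, smul_sub, smul_smul]
  · refine exists_smul_ne_zero_of_sub_mem hμ hinj (c := (tauPoly θ d).eval (θ d))
      (div_ne_zero hζd (hne d le_rfl)) ?_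
    rw [← smul_mul_assoc, ← mul_smul_comm, ← aeval_aT_tauPoly]
    exact gElt_mem_Jideal hζ0 le_rfl
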